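/- Every plane in ℙ³(ℂ) contains exactly one twistor line: for every 3-dimensional ℂ-subspace H of ℂ⁴ there is exactly one 2-dimensional ℂ-subspace W with W ⊆ H and j(W) = W. -/

import Mathlib

noncomputable section

open MvPolynomial

/-- The standard twistor structure `j : ℂ⁴ → ℂ⁴`,
`j(z₁,z₂,z₃,z₄) = (−z̄₂, z̄₁, −z̄₄, z̄₃)`. -/
def J : (Fin 4 → ℂ) → (Fin 4 → ℂ) :=
  fun z => ![-(starRingEnd ℂ) (z 1), (starRingEnd ℂ) (z 0),
             -(starRingEnd ℂ) (z 3), (starRingEnd ℂ) (z 2)]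

/-- A line in `ℙ³(ℂ)`: a 2-dimensional `ℂ`-subspace of `ℂ⁴`. -/
def IsLine (W : Submodule ℂ (Fin 4 → ℂ)) : Prop := Module.finrank ℂ W = 2

/-- A twistor line: a line whose underlying subspace satisfies `j(W) = W`. -/
def IsTwistorLine (W : Submodule ℂ (Fin 4 → ℂ)) : Prop :=
  IsLine W ∧ J '' (W : Set (Fin 4 → ℂ)) = (W : Set (Fin 4 → ℂ))

/-- A polynomial vanishes identically on a subspace. -/
def VanishesOn (f : MvPolynomial (Fin 4) ℂ) (W : Submodule ℂ (Fin 4 → ℂ)) : Prop :=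
  ∀ z ∈ W, eval z f = 0

/-- The surface `{f = 0}` is nonsingular: no nonzero point of `ℂ⁴` is a common zero of
`f` and all its partial derivatives. -/
def Nonsingular (f : MvPolynomial (Fin 4) ℂ) : Prop :=
  ∀ z : Fin 4 → ℂ, z ≠ 0 → eval z f = 0 → ∃ i, eval z (pderiv i f) ≠ 0

theorem J_J (z : Fin 4 → ℂ) : J (J z) = -z := by
  funext i
  fin_cases i <;> simp [J]

/-- The `ℂ`-linear functional `z ↦ conj (φ (J z))`. -/
def conjCompJ (φ : (Fin 4 → ℂ) →ₗ[ℂ] ℂ) : (Fin 4 → ℂ) →ₗ[ℂ] ℂ where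
  toFun z := starRingEnd ℂ (φ (J z))
  map_add' x y := by
    have h : J (x + y) = J x + J y := by
      funext i
      fin_cases i <;> simp [J] <;> ring
    simp [h]
  map_smul' c x := by
    have h : J (c • x) = starRingEnd ℂ c • J x := by
      funext i
      fin_cases i <;> simp [J]
    simp [h]

theorem conjCompJ_apply_eq_zero {φ : (Fin 4 → ℂ) →ₗ[ℂ] ℂ} {z : Fin 4 → ℂ} :
    conjCompJ φ z = 0 ↔ φ (J z) = 0 :=
  map_eq_zero (starRingEnd ℂ)

theorem linearMap_apply_eq (φ : (Fin 4 → ℂ) →ₗ[ℂ] ℂ) (z : Fin 4 → ℂ) :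
    φ z = ∑ i, z i * φ (Pi.single i 1) := by
  rw [φ.pi_apply_eq_sum_univ z]
  refine Finset.sum_congr rfl fun i _ => ?_
  rw [smul_eq_mul]
  congr 2
  funext k
  simp [Pi.single_apply, eq_comm]

/-- The kernel of a nonzero functional is not preserved by `J`. -/
theorem exists_apply_J_ne_zero {φ : (Fin 4 → ℂ) →ₗ[ℂ] ℂ} (hφ : φ ≠ 0) :
    ∃ z, φ z = 0 ∧ φ (J z) ≠ 0 := by
  set n : Fin 4 → ℂ := fun i => starRingEnd ℂ (φ (Pi.single i 1)) with hn
  refine ⟨J n, ?_, ?_⟩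
  · rw [linearMap_apply_eq]
    simp [Fin.sum_univ_four, J, hn]
    ring
  · rw [J_J, map_neg, neg_ne_zero, linearMap_apply_eq]
    intro h
    apply hφ
    have h0 : ∑ i, ‖φ (Pi.single i 1)‖ ^ 2 = 0 := by
      have : ((∑ i, ‖φ (Pi.single i 1)‖ ^ 2 : ℝ) : ℂ) = 0 := by
        rw [← h]
        push_cast
        exact Finset.sum_congr rfl fun i _ => (Complex.conj_mul' _).symm
      exact_mod_cast this
    rw [Finset.sum_eq_zero_iff_of_nonneg fun _ _ => by positivity] at h0
    ext i
    simpa using h0 i (Finset.mem_univ i)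

theorem three_le_finrank_ker (φ : (Fin 4 → ℂ) →ₗ[ℂ] ℂ) :
    3 ≤ Module.finrank ℂ (LinearMap.ker φ) := by
  have h := φ.finrank_range_add_finrank_ker
  have h' := (LinearMap.range φ).finrank_le
  simp only [Module.finrank_fintype_fun_eq_card, Fintype.card_fin, Module.finrank_self] at h h'
  omega

theorem exists_eq_ker_of_finrank_eq_three {H : Submodule ℂ (Fin 4 → ℂ)}
    (hH : Module.finrank ℂ H = 3) :
    ∃ φ : (Fin 4 → ℂ) →ₗ[ℂ] ℂ, φ ≠ 0 ∧ H = LinearMap.ker φ := by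
  have hlt : H < ⊤ := by
    rw [lt_top_iff_ne_top]
    rintro rfl
    simp at hH
  obtain ⟨φ, hφ, hle⟩ := H.exists_le_ker_of_lt_top hlt
  refine ⟨φ, hφ, Submodule.eq_of_le_of_finrank_le hle ?_⟩
  have hker : LinearMap.ker φ ≠ ⊤ := fun h => hφ (LinearMap.ker_eq_top.mp h)
  have := Submodule.finrank_lt hker
  rw [Module.finrank_fintype_fun_eq_card, Fintype.card_fin] at this
  omega

theorem finrank_ker_inf_ker_conjCompJ {φ : (Fin 4 → ℂ) →ₗ[ℂ] ℂ} (hφ : φ ≠ 0)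
    (hker : Module.finrank ℂ (LinearMap.ker φ) = 3) :
    Module.finrank ℂ (LinearMap.ker φ ⊓ LinearMap.ker (conjCompJ φ) : Submodule ℂ _) = 2 := by
  have hsum := Submodule.finrank_sup_add_finrank_inf_eq (LinearMap.ker φ)
    (LinearMap.ker (conjCompJ φ))
  have hsup := (LinearMap.ker φ ⊔ LinearMap.ker (conjCompJ φ)).finrank_le
  rw [Module.finrank_fintype_fun_eq_card, Fintype.card_fin] at hsup
  have hK := three_le_finrank_ker (conjCompJ φ)
  have hlt : LinearMap.ker φ ⊓ LinearMap.ker (conjCompJ φ) < LinearMap.ker φ := by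
    obtain ⟨z, hz, hJz⟩ := exists_apply_J_ne_zero hφ
    refine inf_lt_left.mpr fun hle => hJz ?_
    exact conjCompJ_apply_eq_zero.mp (hle hz)
  have := Submodule.finrank_lt_finrank_of_lt hlt
  omega

theorem image_J_eq_of_forall_mem {W : Submodule ℂ (Fin 4 → ℂ)} (h : ∀ z ∈ W, J z ∈ W) :
    J '' (W : Set (Fin 4 → ℂ)) = (W : Set (Fin 4 → ℂ)) := by
  refine Set.Subset.antisymm (Set.image_subset_iff.mpr h) fun z hz => ?_
  exact ⟨J (-z), h _ (W.neg_mem hz), by rw [J_J, neg_neg]⟩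

/-- Every plane in `ℙ³(ℂ)` contains exactly one twistor line. -/
theorem plane_contains_unique_twistor_line (H : Submodule ℂ (Fin 4 → ℂ))
    (hH : Module.finrank ℂ H = 3) :
    ∃! W : Submodule ℂ (Fin 4 → ℂ),
      IsLine W ∧ W ≤ H ∧ J '' (W : Set (Fin 4 → ℂ)) = (W : Set (Fin 4 → ℂ)) := by
  obtain ⟨φ, hφ, rfl⟩ := exists_eq_ker_of_finrank_eq_three hH
  have hrank := finrank_ker_inf_ker_conjCompJ hφ hH
  refine ⟨LinearMap.ker φ ⊓ LinearMap.ker (conjCompJ φ), ⟨hrank, inf_le_left, ?_⟩, ?_⟩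
  · refine image_J_eq_of_forall_mem fun z hz => ?_
    simp only [Submodule.mem_inf, LinearMap.mem_ker, conjCompJ_apply_eq_zero] at hz ⊢
    exact ⟨hz.2, by rw [J_J, map_neg, hz.1, neg_zero]⟩
  · rintro W ⟨hW, hle, hJ⟩
    refine Submodule.eq_of_le_of_finrank_eq (fun z hz => ⟨hle hz, ?_⟩) (hW.trans hrank.symm)
    exact conjCompJ_apply_eq_zero.mpr (hle (hJ.subset (Set.mem_image_of_mem J hz)))
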